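/- arXiv:1511.04068 — 2 statements merged into one kernel-verified Lean document; each statement's English description precedes it below -/
import Mathlib

section
/- Let A be a nonempty set of integers, each at least 2, let S_A = {(1,−1)} ∪ {(−i,j) : i ≥ 0, j ≥ 0, i+j+2 ∈ A} ⊆ ℤ², and let b = gcd({k/2 : k ∈ A, k even} ∪ {k : k ∈ A, k odd}). Then there exists N such that for every t ≥ N with b | t, there is a sequence of t steps from S_A whose total sum is (0,0); that is, the walk with steps in S_A can return to its starting point after any sufficiently large multiple of b steps. -/
/-- The set `{k/2 : k ∈ A, k even} ∪ {k : k ∈ A, k odd}` associated to a set `A` of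
allowed face sizes. -/
def halfOddSet (A : Set ℕ) : Set ℕ :=
  {q | (∃ k ∈ A, Even k ∧ k = 2 * q) ∨ (∃ k ∈ A, Odd k ∧ k = q)}

/-- `b` is the greatest common divisor of the (possibly infinite) set `B ⊆ ℕ`:
it divides every element, and every common divisor of `B` divides it. -/
def IsGcdOfSet (b : ℕ) (B : Set ℕ) : Prop :=
  (∀ x ∈ B, b ∣ x) ∧ ∀ d : ℕ, (∀ x ∈ B, d ∣ x) → d ∣ b

/-- The bipolar step set `S_A = {(1,-1)} ∪ {(-i,j) : i,j ≥ 0, i+j+2 ∈ A} ⊆ ℤ²`. -/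
def bipolarSteps (A : Set ℕ) : Set (ℤ × ℤ) :=
  {p | p = (1, -1) ∨ ∃ i j : ℕ, i + j + 2 ∈ A ∧ p = (-(i : ℤ), (j : ℤ))}

/-- `S_A` has closed walks of every length in `{k/2 : k ∈ A, k even} ∪ {k : k ∈ A, k odd}`. -/
theorem exists_closed_walk_of_mem_halfOddSet {A : Set ℕ} (hA2 : ∀ k ∈ A, 2 ≤ k)
    {q : ℕ} (hq : q ∈ halfOddSet A) :
    ∃ l : List (ℤ × ℤ), (∀ p ∈ l, p ∈ bipolarSteps A) ∧ l.length = q ∧ l.sum = (0, 0) := by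
  rcases hq with ⟨k, hk, -, rfl⟩ | ⟨k, hk, ⟨m, rfl⟩, rfl⟩
  · obtain ⟨n, rfl⟩ : ∃ n, q = n + 1 := ⟨q - 1, by have := hA2 _ hk; lia⟩
    refine ⟨(-(n : ℤ), (n : ℤ)) :: List.replicate n (1, -1), ?_, by simp, by simp⟩
    intro p hp
    rcases List.mem_cons.1 hp with rfl | hp
    · exact Or.inr ⟨n, n, by convert hk using 1; ring, rfl⟩
    · exact Or.inl (List.eq_of_mem_replicate hp)
  · obtain ⟨n, rfl⟩ : ∃ n, m = n + 1 := ⟨m - 1, by have := hA2 _ hk; lia⟩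
    refine ⟨(-((n + 1 : ℕ) : ℤ), (n : ℤ)) :: (-(n : ℤ), ((n + 1 : ℕ) : ℤ)) ::
      List.replicate (2 * n + 1) (1, -1), ?_, by simp; ring, by ext <;> simp <;> ring⟩
    intro p hp
    rcases List.mem_cons.1 hp with rfl | hp
    · exact Or.inr ⟨n + 1, n, by convert hk using 1; ring, rfl⟩
    rcases List.mem_cons.1 hp with rfl | hp
    · exact Or.inr ⟨n, n + 1, by convert hk using 1; ring, rfl⟩
    · exact Or.inl (List.eq_of_mem_replicate hp)

/-- The walk with steps in `S_A` can return to its starting point after any sufficiently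
large multiple of `b = gcd({k/2 : k ∈ A even} ∪ {k : k ∈ A odd})` steps. -/
theorem closed_walk_exists_for_large_multiples_of_period
    (A : Set ℕ) (hA : A.Nonempty) (hA2 : ∀ k ∈ A, 2 ≤ k)
    (b : ℕ) (hb : IsGcdOfSet b (halfOddSet A)) :
    ∃ N : ℕ, ∀ t : ℕ, N ≤ t → b ∣ t →
      ∃ l : List (ℤ × ℤ), (∀ p ∈ l, p ∈ bipolarSteps A) ∧
        l.length = t ∧ l.sum = (0, 0) := by
  obtain ⟨N, hN⟩ := Nat.exists_mem_closure_of_ge (halfOddSet A)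
  refine ⟨N, fun t ht hbt => ?_⟩
  have hgcd : Nat.setGcd (halfOddSet A) ∣ b := hb.2 _ fun x hx => Nat.setGcd_dvd_of_mem hx
  have hmem := hN t ht (hgcd.trans hbt)
  clear ht hbt
  induction hmem using AddSubmonoid.closure_induction with
  | mem q hq => exact exists_closed_walk_of_mem_halfOddSet hA2 hq
  | zero => exact ⟨[], by simp, rfl, rfl⟩
  | add x y _ _ hx hy =>
    obtain ⟨l, hl, rfl, hl0⟩ := hx
    obtain ⟨l', hl', rfl, hl0'⟩ := hy
    exact ⟨l ++ l', fun p hp => (List.mem_append.1 hp).elim (hl p) (hl' p),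
      List.length_append, by simp [hl0, hl0']⟩
end

section
/- Let (a_k)_{k≥2} be nonnegative real numbers and λ > 0 a real number such that Σ_{k≥2} ((k−1)(k−2)/2)·a_k·λ^k converges and equals 1, C := λ^{−2} + Σ_{k≥2} (k−1)·a_k·λ^{k−2} is finite, and additionally Σ_{k≥2} k³·a_k·λ^k < ∞. Define ν : ℤ² → ℝ by ν(1,−1) = λ^{−2}/C, ν(−i,j) = a_{i+j+2}·λ^{i+j}/C for integers i, j ≥ 0, and ν = 0 otherwise. Then both sums Σ_{z∈ℤ²} (z₁ − z₂)²·ν(z) and Σ_{z∈ℤ²} (z₁ + z₂)²·ν(z) are finite, and Σ_{z∈ℤ²} (z₁ − z₂)²·ν(z) = 3 · Σ_{z∈ℤ²} (z₁ + z₂)²·ν(z). -/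
/-- The step distribution `ν` of the lattice walk associated to face weights `(a_k)`,
tilt `λ` and normalization `C`: `ν(1,-1) = λ⁻²/C`, `ν(-i,j) = a_{i+j+2}·λ^{i+j}/C` for
`i, j ≥ 0`, and `ν = 0` elsewhere. -/
noncomputable def bipolarStepDist (a : ℕ → ℝ) (lam C : ℝ) : ℤ × ℤ → ℝ := fun z =>
  if z = (1, -1) then lam ^ (-2 : ℤ) / C
  else if z.1 ≤ 0 ∧ 0 ≤ z.2 then
    a ((-z.1).toNat + z.2.toNat + 2) * lam ^ ((-z.1).toNat + z.2.toNat) / C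
  else 0

/-- A nonnegative function on `ℕ × ℕ` whose sums along antidiagonals sum to `s` has sum `s`. -/
theorem hasSum_of_hasSum_sum_antidiagonal {f : ℕ × ℕ → ℝ} (hf : ∀ p, 0 ≤ f p) {s : ℝ}
    (h : HasSum (fun n => ∑ p ∈ Finset.HasAntidiagonal.antidiagonal n, f p) s) : HasSum f s := by
  rw [← Finset.HasAntidiagonal.sigmaAntidiagonalEquivProd.hasSum_iff]
  have hfiber (n : ℕ) : HasSum
      (fun p : Finset.HasAntidiagonal.antidiagonal n =>
        (f ∘ Finset.HasAntidiagonal.sigmaAntidiagonalEquivProd) ⟨n, p⟩)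
      (∑ p ∈ Finset.HasAntidiagonal.antidiagonal n, f p) := by
    rw [← Finset.sum_coe_sort]
    exact hasSum_fintype _
  have hsum : Summable (f ∘ Finset.HasAntidiagonal.sigmaAntidiagonalEquivProd) := by
    refine (summable_sigma_of_nonneg fun _ => hf _).mpr ⟨fun n => (hfiber n).summable, ?_⟩
    exact h.summable.congr fun n => (hfiber n).tsum_eq.symm
  have := hsum.hasSum.sigma hfiber
  rw [h.unique this]
  exact hsum.hasSum

theorem sum_range_sub_two_mul_sq (x : ℝ) (m : ℕ) :
    ∑ i ∈ Finset.range m, (x - 2 * (i : ℝ)) ^ 2 =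
      m * x ^ 2 - 2 * x * (m * (m - 1)) + 2 * (m * (m - 1) * (2 * m - 1)) / 3 := by
  induction m with
  | zero => simp
  | succ k ih =>
    rw [Finset.sum_range_succ, ih]
    push_cast
    ring

theorem sum_antidiagonal_neg_add_sq (n : ℕ) :
    ∑ p ∈ Finset.HasAntidiagonal.antidiagonal n, (-(p.1 : ℝ) + p.2) ^ 2 =
      n * (n + 1) * (n + 2) / 3 := by
  rw [Finset.Nat.sum_antidiagonal_eq_sum_range_succ_mk]
  have h : ∀ i ∈ Finset.range (n + 1),
      (-(i : ℝ) + ((n - i : ℕ) : ℝ)) ^ 2 = ((n : ℝ) - 2 * i) ^ 2 := by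
    intro i hi
    rw [Nat.cast_sub (Finset.mem_range_succ_iff.mp hi)]
    ring
  rw [Finset.sum_congr rfl h, sum_range_sub_two_mul_sq]
  push_cast
  ring

theorem sum_antidiagonal_neg_sub_sq (n : ℕ) :
    ∑ p ∈ Finset.HasAntidiagonal.antidiagonal n, (-(p.1 : ℝ) - p.2) ^ 2 = n ^ 2 * (n + 1) := by
  have h : ∀ p ∈ Finset.HasAntidiagonal.antidiagonal n, (-(p.1 : ℝ) - p.2) ^ 2 = (n : ℝ) ^ 2 := by
    intro p hp
    rw [← Finset.HasAntidiagonal.mem_antidiagonal.mp hp]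
    push_cast
    ring
  rw [Finset.sum_congr rfl h]
  simp [mul_comm]

/-- Sums against `bipolarStepDist`, with the face steps grouped by face degree. -/
theorem hasSum_mul_bipolarStepDist {a : ℕ → ℝ} (ha : ∀ k, 0 ≤ a k) {lam C : ℝ}
    (hlam : 0 < lam) (hC : 0 < C) {g : ℤ × ℤ → ℝ} (hg : ∀ z, 0 ≤ g z) {s : ℝ}
    (h : HasSum (fun n : ℕ =>
      (∑ p ∈ Finset.HasAntidiagonal.antidiagonal n, g (-(p.1 : ℤ), (p.2 : ℤ))) *
        a (n + 2) * lam ^ (n + 2)) s) :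
    HasSum (fun z => g z * bipolarStepDist a lam C z)
      (lam ^ (-2 : ℤ) / C * (g (1, -1) + s)) := by
  have hface : HasSum (fun z => if z = (1, -1) then 0 else g z * bipolarStepDist a lam C z)
      (lam ^ (-2 : ℤ) / C * s) := by
    have hinj : Function.Injective fun p : ℕ × ℕ => ((-(p.1 : ℤ), (p.2 : ℤ)) : ℤ × ℤ) := by
      rintro ⟨i, j⟩ ⟨k, l⟩ hp
      simpa using hp
    rw [← hinj.hasSum_iff]
    · have hval (p : ℕ × ℕ) : ((fun z => if z = (1, -1) then 0 else
            g z * bipolarStepDist a lam C z) ∘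
            fun p : ℕ × ℕ => ((-(p.1 : ℤ), (p.2 : ℤ)) : ℤ × ℤ)) p =
          g (-(p.1 : ℤ), (p.2 : ℤ)) * (a (p.1 + p.2 + 2) * lam ^ (p.1 + p.2) / C) := by
        have hne : ((-(p.1 : ℤ), (p.2 : ℤ)) : ℤ × ℤ) ≠ (1, -1) := by
          simp only [ne_eq, Prod.mk.injEq]
          omega
        simp [bipolarStepDist, hne]
      refine hasSum_of_hasSum_sum_antidiagonal (fun p => ?_) ?_
      · rw [hval]
        have := hg (-(p.1 : ℤ), (p.2 : ℤ))
        have := ha (p.1 + p.2 + 2)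
        positivity
      · refine HasSum.congr_fun (h.mul_left (lam ^ (-2 : ℤ) / C)) fun n => ?_
        rw [mul_assoc, Finset.sum_mul, Finset.mul_sum]
        refine Finset.sum_congr rfl fun p hp => ?_
        rw [hval, Finset.HasAntidiagonal.mem_antidiagonal.mp hp, zpow_neg, pow_add]
        norm_cast
        field_simp
    · rintro ⟨x, y⟩ hz
      have hz' : ¬ (x ≤ 0 ∧ 0 ≤ y) := fun ⟨hx, hy⟩ =>
        hz ⟨((-x).toNat, y.toNat), by simp [hx, hy]⟩
      simp +contextual [bipolarStepDist, hz']
  have hedge := hasSum_ite_eq ((1, -1) : ℤ × ℤ) (lam ^ (-2 : ℤ) / C * g (1, -1))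
  rw [mul_add]
  refine HasSum.congr_fun (hedge.add hface) fun z => ?_
  split_ifs with hz
  · simp [hz, bipolarStepDist, mul_comm]
  · simp

/-- Under the zero-drift condition and a finite third moment `Σ_{k≥2} k³·a_k·λ^k < ∞`,
the step distribution `ν` satisfies `Var(X−Y) = 3·Var(X+Y)`: both sums
`Σ (z₁−z₂)²·ν(z)` and `Σ (z₁+z₂)²·ν(z)` are finite and the first equals three times the
second. (Sums over `k ≥ 2` are written with the index shifted by `2`.) -/
theorem bipolarStepDist_variance_ratio_three
    (a : ℕ → ℝ) (ha : ∀ k, 0 ≤ a k) (lam : ℝ) (hlam : 0 < lam)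
    (hdriftSummable : Summable (fun k : ℕ =>
      (((k : ℝ) + 1) * (k : ℝ) / 2) * a (k + 2) * lam ^ (k + 2)))
    (hdrift : ∑' k : ℕ, (((k : ℝ) + 1) * (k : ℝ) / 2) * a (k + 2) * lam ^ (k + 2) = 1)
    (C : ℝ)
    (hCsummable : Summable (fun k : ℕ => ((k : ℝ) + 1) * a (k + 2) * lam ^ k))
    (hC : C = lam ^ (-2 : ℤ) + ∑' k : ℕ, ((k : ℝ) + 1) * a (k + 2) * lam ^ k)
    (hthird : Summable (fun k : ℕ => ((k : ℝ) + 2) ^ 3 * a (k + 2) * lam ^ (k + 2))) :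
    Summable (fun z : ℤ × ℤ => ((z.1 : ℝ) - (z.2 : ℝ)) ^ 2 * bipolarStepDist a lam C z) ∧
    Summable (fun z : ℤ × ℤ => ((z.1 : ℝ) + (z.2 : ℝ)) ^ 2 * bipolarStepDist a lam C z) ∧
    ∑' z : ℤ × ℤ, ((z.1 : ℝ) - (z.2 : ℝ)) ^ 2 * bipolarStepDist a lam C z =
      3 * ∑' z : ℤ × ℤ, ((z.1 : ℝ) + (z.2 : ℝ)) ^ 2 * bipolarStepDist a lam C z := by
  have hCpos : 0 < C := by
    have : 0 ≤ ∑' k : ℕ, ((k : ℝ) + 1) * a (k + 2) * lam ^ k :=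
      tsum_nonneg fun k => by have := ha (k + 2); positivity
    rw [hC]
    positivity
  have hdrift' : HasSum (fun k : ℕ =>
      (((k : ℝ) + 1) * (k : ℝ) / 2) * a (k + 2) * lam ^ (k + 2)) 1 :=
    by simpa only [hdrift] using hdriftSummable.hasSum
  have hsum : Summable fun n : ℕ =>
      ((n : ℝ) * (n + 1) * (n + 2) / 3) * a (n + 2) * lam ^ (n + 2) := by
    refine hthird.of_nonneg_of_le (fun n => ?_) (fun n => ?_)
    · have := ha (n + 2)
      positivity
    · have := ha (n + 2)
      gcongr
      have : (0 : ℝ) ≤ n := n.cast_nonneg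
      nlinarith [mul_nonneg this this, mul_nonneg this (mul_nonneg this this)]
  obtain ⟨S, hS⟩ := hsum
  have hadd : HasSum
      (fun z : ℤ × ℤ => ((z.1 : ℝ) + (z.2 : ℝ)) ^ 2 * bipolarStepDist a lam C z)
      (lam ^ (-2 : ℤ) / C * S) := by
    have := hasSum_mul_bipolarStepDist ha hlam hCpos
      (g := fun z => ((z.1 : ℝ) + (z.2 : ℝ)) ^ 2) (fun _ => sq_nonneg _) (s := S)
      (by simpa [sum_antidiagonal_neg_add_sq] using hS)
    simpa using this
  have hsub : HasSum
      (fun z : ℤ × ℤ => ((z.1 : ℝ) - (z.2 : ℝ)) ^ 2 * bipolarStepDist a lam C z)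
      (lam ^ (-2 : ℤ) / C * (4 + (3 * S - 4 * 1))) := by
    have hdiff : HasSum (fun n : ℕ => ((n : ℝ) ^ 2 * (n + 1)) * a (n + 2) * lam ^ (n + 2))
        (3 * S - 4 * 1) := by
      refine HasSum.congr_fun ((hS.mul_left 3).sub (hdrift'.mul_left 4)) fun n => ?_
      ring
    have := hasSum_mul_bipolarStepDist ha hlam hCpos
      (g := fun z => ((z.1 : ℝ) - (z.2 : ℝ)) ^ 2) (fun _ => sq_nonneg _) (s := 3 * S - 4 * 1)
      (by simpa [sum_antidiagonal_neg_sub_sq] using hdiff)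
    convert this using 3
    norm_num
  refine ⟨hsub.summable, hadd.summable, ?_⟩
  rw [hsub.tsum_eq, hadd.tsum_eq]
  ring
end
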